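/- Let q be a prime, α ∈ 𝔽_q nonzero, δ ∈ [0,1], and let (U_1,A_1),…,(U_4,A_4) be i.i.d. pairs of random variables with U_i taking values in 𝔽_q and A_i taking values in a finite alphabet Σ. Suppose f : Σ → 𝔽_q satisfies ℙ(f(A_i) ≠ U_i) ≤ δ. Then there exists a function g : 𝔽_q × 𝔽_q × Σ⁴ → 𝔽_q such that ℙ(g(U_2 + α·U_4, U_3 + α·U_4, A_1, A_2, A_3, A_4) ≠ U_4) ≤ 3δ². -/

import Mathlib

open scoped BigOperators

/- Probability of an event under a probability mass function on a finite type. -/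
open Classical in
noncomputable def pmfProb {Ω : Type} [Fintype Ω] (μ : Ω → ℝ) (S : Set Ω) : ℝ :=
  ∑ ω : Ω, if ω ∈ S then μ ω else 0

section PmfProb

variable {Ω : Type} [Fintype Ω] {μ : Ω → ℝ}

open Classical in
/-- The probability of an event about `X` is a sum over the values of `X`. -/
theorem pmfProb_mem_eq_sum {β : Type*} [Fintype β] (X : Ω → β) (S : Set β) :
    pmfProb μ {ω | X ω ∈ S} = ∑ x, if x ∈ S then pmfProb μ {ω | X ω = x} else 0 := by
  have hfiber (x : β) : (if x ∈ S then pmfProb μ {ω | X ω = x} else 0) =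
      ∑ ω, if X ω = x then (if X ω ∈ S then μ ω else 0) else 0 := by
    by_cases hx : x ∈ S
    · simp only [hx, if_true, pmfProb, Set.mem_ofPred_eq]
      exact Finset.sum_congr rfl fun ω _ => by split_ifs <;> simp_all
    · rw [if_neg hx, Finset.sum_eq_zero]
      intro ω _
      split_ifs <;> simp_all
  rw [Finset.sum_congr rfl fun x _ => hfiber x, Finset.sum_comm]
  simp [pmfProb]

theorem pmfProb_mono (hμ : ∀ ω, 0 ≤ μ ω) {S T : Set Ω} (h : S ⊆ T) :
    pmfProb μ S ≤ pmfProb μ T := by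
  classical
  simp only [pmfProb, ← Finset.sum_filter]
  exact Finset.sum_le_sum_of_subset_of_nonneg
    (Finset.monotone_filter_right _ fun _ _ hω => h hω) fun ω _ _ => hμ ω

theorem pmfProb_nonneg (hμ : ∀ ω, 0 ≤ μ ω) (S : Set Ω) : 0 ≤ pmfProb μ S :=
  Finset.sum_nonneg fun ω _ => by split_ifs <;> simp [hμ ω]

theorem pmfProb_union_le (hμ : ∀ ω, 0 ≤ μ ω) (S T : Set Ω) :
    pmfProb μ (S ∪ T) ≤ pmfProb μ S + pmfProb μ T := by
  rw [pmfProb, pmfProb, pmfProb, ← Finset.sum_add_distrib]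
  refine Finset.sum_le_sum fun ω _ => ?_
  by_cases hS : ω ∈ S <;> by_cases hT : ω ∈ T <;> simp [hS, hT, hμ ω]

/-- Among i.i.d. variables, the events that two different ones lie in `B` are independent. -/
theorem pmfProb_pair_eq_mul {ι : Type*} {β : Type*} [Fintype ι] [Fintype β]
    (hμ : ∑ ω, μ ω = 1) (W : ι → Ω → β) (p : β → ℝ)
    (hmarg : ∀ i b, pmfProb μ {ω | W i ω = b} = p b)
    (hjoint : ∀ w : ι → β, pmfProb μ {ω | ∀ i, W i ω = w i} = ∏ i, p (w i))
    (B : Set β) {i j : ι} (hij : i ≠ j) :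
    pmfProb μ {ω | W i ω ∈ B ∧ W j ω ∈ B} =
      pmfProb μ {ω | W i ω ∈ B} * pmfProb μ {ω | W j ω ∈ B} := by
  classical
  have hp : ∑ b, p b = 1 := by
    have h := pmfProb_mem_eq_sum (μ := μ) (W i) Set.univ
    simp only [Set.mem_univ, if_true, hmarg] at h
    rw [← h, ← hμ]
    simp [pmfProb]
  have hsingle (k : ι) : pmfProb μ {ω | W k ω ∈ B} = ∑ b, if b ∈ B then p b else 0 := by
    simp only [pmfProb_mem_eq_sum (W k) B, hmarg]
  have hpair := pmfProb_mem_eq_sum (μ := μ) (fun ω k => W k ω) {w | w i ∈ B ∧ w j ∈ B}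
  simp only [Set.mem_ofPred_eq, funext_iff, hjoint] at hpair
  calc
    _ = ∑ w : ι → β, ∏ k, if k = i ∨ k = j → w k ∈ B then p (w k) else 0 := by
      rw [hpair]
      refine Finset.sum_congr rfl fun w _ => ?_
      rw [Finset.prod_ite_zero]
      simp [or_imp, forall_and]
    _ = ∏ k, ∑ b, if k = i ∨ k = j → b ∈ B then p b else 0 := by
      rw [Finset.prod_univ_sum, Fintype.piFinset_univ]
    _ = _ := by
      rw [hsingle, hsingle, Fintype.prod_eq_mul i j hij]
      · simp
      · rintro k ⟨hi, hj⟩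
        simp [hi, hj, hp]

end PmfProb

/-- given i.i.d. pairs `(U_1,A_1),…,(U_4,A_4)` and a predictor `f` with
`ℙ(f(A_i) ≠ U_i) ≤ δ`, there is a predictor `g` of `U_4` from
`(U_2 + α·U_4, U_3 + α·U_4, A_1, …, A_4)` with error probability at most `3δ²`.
(Indices are 0-based: `U 3` is `U_4`, etc.) -/
theorem stmt14 (q : ℕ) [NeZero q] (hq : Nat.Prime q) (α : ZMod q) (hα : α ≠ 0)
    (δ : ℝ) (hδ0 : 0 ≤ δ) (hδ1 : δ ≤ 1)
    (Ω Alph : Type) [Fintype Ω] [Fintype Alph]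
    (μ : Ω → ℝ) (hμ0 : ∀ ω, 0 ≤ μ ω) (hμ1 : ∑ ω : Ω, μ ω = 1)
    (U : Fin 4 → Ω → ZMod q) (A : Fin 4 → Ω → Alph)
    -- the pairs (U_i, A_i) are i.i.d. with common marginal p
    (hiid : ∃ p : ZMod q × Alph → ℝ,
      (∀ (i : Fin 4) (u : ZMod q) (a : Alph),
          pmfProb μ {ω | U i ω = u ∧ A i ω = a} = p (u, a)) ∧
      (∀ (u : Fin 4 → ZMod q) (a : Fin 4 → Alph),
          pmfProb μ {ω | ∀ i, U i ω = u i ∧ A i ω = a i} = ∏ i, p (u i, a i)))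
    (f : Alph → ZMod q) (hf : ∀ i : Fin 4, pmfProb μ {ω | f (A i ω) ≠ U i ω} ≤ δ) :
    ∃ g : ZMod q → ZMod q → (Fin 4 → Alph) → ZMod q,
      pmfProb μ
        {ω | g (U 1 ω + α * U 3 ω) (U 2 ω + α * U 3 ω) (fun i => A i ω) ≠ U 3 ω}
        ≤ 3 * δ ^ 2 := by
  have : Fact q.Prime := ⟨hq⟩
  obtain ⟨p, hmarg, hjoint⟩ := hiid
  let bad (i : Fin 4) : Set Ω := {ω | f (A i ω) ≠ U i ω}
  have hpair {i j : Fin 4} (hij : i ≠ j) : pmfProb μ (bad i ∩ bad j) ≤ δ ^ 2 := by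
    have h := pmfProb_pair_eq_mul hμ1 (fun i ω => (U i ω, A i ω)) p
      (fun i b => by simpa [Prod.ext_iff] using hmarg i b.1 b.2)
      (fun w => by simpa [Prod.ext_iff] using hjoint (fun i => (w i).1) fun i => (w i).2)
      {b | f b.2 ≠ b.1} hij
    calc pmfProb μ (bad i ∩ bad j) = pmfProb μ (bad i) * pmfProb μ (bad j) := h
      _ ≤ δ * δ := mul_le_mul (hf i) (hf j) (pmfProb_nonneg hμ0 _) hδ0
      _ = δ ^ 2 := (sq δ).symm
  -- Majority vote between the three estimates of `U 3` given by `f (A 1)`, `f (A 2)`, `f (A 3)`.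
  refine ⟨fun s t a => if (s - f (a 1)) / α = (t - f (a 2)) / α then (s - f (a 1)) / α
    else f (a 3), ?_⟩
  have hsub : {ω | (if (U 1 ω + α * U 3 ω - f (A 1 ω)) / α = (U 2 ω + α * U 3 ω - f (A 2 ω)) / α
      then (U 1 ω + α * U 3 ω - f (A 1 ω)) / α else f (A 3 ω)) ≠ U 3 ω} ⊆
      (bad 1 ∩ bad 2) ∪ ((bad 1 ∩ bad 3) ∪ (bad 2 ∩ bad 3)) := by
    intro ω hω
    have hest {x : ZMod q} {i : Fin 4} (hi : f (A i ω) = x) :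
        (x + α * U 3 ω - f (A i ω)) / α = U 3 ω := by
      rw [hi, add_sub_cancel_left, mul_div_cancel_left₀ _ hα]
    simp only [Set.mem_ofPred_eq] at hω
    simp only [bad, Set.mem_union, Set.mem_inter_iff, Set.mem_ofPred_eq]
    by_cases h1 : f (A 1 ω) = U 1 ω <;> by_cases h2 : f (A 2 ω) = U 2 ω <;>
      by_cases h3 : f (A 3 ω) = U 3 ω <;> grind
  have h12 := hpair (i := 1) (j := 2) (by decide)
  have h13 := hpair (i := 1) (j := 3) (by decide)
  have h23 := hpair (i := 2) (j := 3) (by decide)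
  have hle := (pmfProb_mono hμ0 hsub).trans (pmfProb_union_le hμ0 _ _)
  have hle' := pmfProb_union_le hμ0 (bad 1 ∩ bad 3) (bad 2 ∩ bad 3)
  linarith
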